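/- arXiv:0803.0417 — 2 statements merged into one kernel-verified Lean document; each statement's English description precedes it below -/
import Mathlib

section
/- Let L be a complete lattice, K ⊆ L a subset closed under arbitrary suprema, and F ⊆ K an upper set in K (for all q ∈ F and k ∈ K with q ≤ k, k ∈ F). Let E : ℝ → L be any function. Then {λ ∈ ℝ | δᶦ_K(E(λ)) ∈ F} = {λ ∈ ℝ | ∃ q ∈ F, q ≤ E(λ)}. In particular the two sets have the same infimum: sInf {λ | δᶦ_K(E(λ)) ∈ F} = sInf {λ | E(λ) ∈ 𝒞(F)}, where 𝒞(F) := {x ∈ L | ∃ q ∈ F, q ≤ x}. -/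
/-- Inner daseinisation of `a` to `K` in a complete lattice:
`δᶦ_K(a) := sSup {k ∈ K | k ≤ a}`. -/
def innerDas {L : Type*} [CompleteLattice L] (K : Set L) (a : L) : L :=
  sSup {k ∈ K | k ≤ a}

theorem innerDas_le {L : Type*} [CompleteLattice L] (K : Set L) (a : L) : innerDas K a ≤ a :=
  sSup_le fun _ hk => hk.2

theorem le_innerDas {L : Type*} [CompleteLattice L] {K : Set L} {a k : L} (hk : k ∈ K)
    (hka : k ≤ a) : k ≤ innerDas K a :=
  le_sSup ⟨hk, hka⟩

theorem innerDas_mem_iff {L : Type*} [CompleteLattice L] {K : Set L}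
    (hSup : ∀ S : Set L, S ⊆ K → sSup S ∈ K) {F : Set L} (hFK : F ⊆ K)
    (hup : ∀ q ∈ F, ∀ k ∈ K, q ≤ k → k ∈ F) (a : L) :
    innerDas K a ∈ F ↔ ∃ q ∈ F, q ≤ a :=
  ⟨fun h => ⟨_, h, innerDas_le K a⟩, fun ⟨q, hq, hqa⟩ =>
    hup q hq _ (hSup _ fun _ hk => hk.1) (le_innerDas (hFK hq) hqa)⟩

/-- If `K` is closed under arbitrary suprema, `F ⊆ K` is an upper set in `K`,
and `E : ℝ → L` is any function, then
`{λ | δᶦ_K(E(λ)) ∈ F} = {λ | ∃ q ∈ F, q ≤ E(λ)}`; in particular the two sets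
have the same infimum, where the second set is rephrased via the cone
`𝒞(F) = {x | ∃ q ∈ F, q ≤ x}`. -/
theorem innerDas_observable_function {L : Type*} [CompleteLattice L] (K : Set L)
    (hSup : ∀ S : Set L, S ⊆ K → sSup S ∈ K)
    (F : Set L) (hFK : F ⊆ K)
    (hup : ∀ q ∈ F, ∀ k ∈ K, q ≤ k → k ∈ F)
    (E : ℝ → L) :
    ({t : ℝ | innerDas K (E t) ∈ F} = {t : ℝ | ∃ q ∈ F, q ≤ E t}) ∧
    sInf {t : ℝ | innerDas K (E t) ∈ F} =
      sInf {t : ℝ | E t ∈ {x : L | ∃ q ∈ F, q ≤ x}} := by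
  have h : {t : ℝ | innerDas K (E t) ∈ F} = {t : ℝ | ∃ q ∈ F, q ≤ E t} :=
    Set.ext fun t => innerDas_mem_iff hSup hFK hup (E t)
  exact ⟨h, congrArg sInf h⟩
end

section
/- Let L be a complete lattice, c : L → L an antitone involution (c ∘ c = id and a ≤ b implies c(b) ≤ c(a)), and K ⊆ L a subset closed under arbitrary infima and arbitrary suprema with c(K) = K. Let F ⊆ K be an upper set in K, and let E : ℝ → L be monotone. Define S₁ := {λ ∈ ℝ | c(⨅_{μ > λ} δᵒ_K(E(μ))) ∈ F} and S₂ := {λ ∈ ℝ | ∃ q ∈ F, q ≤ c(E(λ))}. Then S₁ ⊆ S₂, and for every λ ∈ S₂ and every λ' < λ one has λ' ∈ S₁; consequently sSup S₁ = sSup S₂ (suprema taken in ℝ). -/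
/-- Outer daseinisation of `a` to `K` in a complete lattice:
`δᵒ_K(a) := sInf {k ∈ K | a ≤ k}`. -/
def outerDas {L : Type*} [CompleteLattice L] (K : Set L) (a : L) : L :=
  sInf {k ∈ K | a ≤ k}

theorem outerDas_le {L : Type*} [CompleteLattice L] {K : Set L} {a k : L}
    (hk : k ∈ K) (h : a ≤ k) : outerDas K a ≤ k :=
  sInf_le ⟨hk, h⟩

theorem le_outerDas {L : Type*} [CompleteLattice L] (K : Set L) (a : L) :
    a ≤ outerDas K a :=
  le_sInf fun _ hk => hk.2

/-- A set of reals and a subset containing everything strictly below one of its elements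
have the same supremum. -/
theorem Real.sSup_eq_sSup_of_subset_of_forall_lt_mem {A B : Set ℝ} (hAB : A ⊆ B)
    (h : ∀ t ∈ B, ∀ t' < t, t' ∈ A) : sSup A = sSup B := by
  rcases B.eq_empty_or_nonempty with rfl | ⟨b, hb⟩
  · rw [Set.subset_empty_iff.mp hAB]
  have hA : A.Nonempty := ⟨b - 1, h b hb _ (sub_one_lt b)⟩
  have hbounds : upperBounds A = upperBounds B :=
    Set.Subset.antisymm
      (fun _ hu t ht => le_of_forall_lt_imp_le_of_dense fun t' ht' => hu (h t ht t' ht'))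
      (upperBounds_mono_set hAB)
  by_cases hB : BddAbove B
  · refine (isLUB_csSup hA (hB.mono hAB)).unique ?_
    simpa only [IsLUB, hbounds] using isLUB_csSup ⟨b, hb⟩ hB
  · have hA' : ¬ BddAbove A := by rwa [BddAbove, hbounds]
    rw [Real.sSup_of_not_bddAbove hA', Real.sSup_of_not_bddAbove hB]

/-- Antonymous-function theorem: for an antitone involution `c`, a sub-complete-lattice
`K` stable under `c`, an upper set `F ⊆ K` and a monotone `E : ℝ → L`, set
`S₁ = {λ | c(⨅_{μ>λ} δᵒ_K(E μ)) ∈ F}` and `S₂ = {λ | ∃ q ∈ F, q ≤ c (E λ)}`.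
Then `S₁ ⊆ S₂`, every `λ' < λ ∈ S₂` lies in `S₁`, and `sSup S₁ = sSup S₂`. -/
theorem antonymous_daseinisation {L : Type*} [CompleteLattice L]
    (c : L → L) (hinv : ∀ a, c (c a) = a) (hanti : ∀ a b : L, a ≤ b → c b ≤ c a)
    (K : Set L)
    (hInf : ∀ S : Set L, S ⊆ K → sInf S ∈ K)
    (hSup : ∀ S : Set L, S ⊆ K → sSup S ∈ K)
    (hcK : c '' K = K)
    (F : Set L) (hFK : F ⊆ K)
    (hup : ∀ q ∈ F, ∀ k ∈ K, q ≤ k → k ∈ F)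
    (E : ℝ → L) (hE : Monotone E) :
    ({t : ℝ | c (⨅ μ ∈ Set.Ioi t, outerDas K (E μ)) ∈ F} ⊆
        {t : ℝ | ∃ q ∈ F, q ≤ c (E t)}) ∧
    (∀ t ∈ {t : ℝ | ∃ q ∈ F, q ≤ c (E t)}, ∀ t' < t,
        t' ∈ {s : ℝ | c (⨅ μ ∈ Set.Ioi s, outerDas K (E μ)) ∈ F}) ∧
    sSup {t : ℝ | c (⨅ μ ∈ Set.Ioi t, outerDas K (E μ)) ∈ F} =
      sSup {t : ℝ | ∃ q ∈ F, q ≤ c (E t)} := by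
  have hcK_mem : ∀ k ∈ K, c k ∈ K := fun k hk => hcK ▸ Set.mem_image_of_mem c hk
  have houter : ∀ a, outerDas K a ∈ K := fun a => hInf _ fun _ hk => hk.1
  have hsub : {t : ℝ | c (⨅ μ ∈ Set.Ioi t, outerDas K (E μ)) ∈ F} ⊆
      {t : ℝ | ∃ q ∈ F, q ≤ c (E t)} := fun t ht =>
    ⟨_, ht, hanti _ _ (le_iInf₂ fun μ hμ =>
      (hE (le_of_lt hμ)).trans (le_outerDas K (E μ)))⟩
  have hlt : ∀ t ∈ {t : ℝ | ∃ q ∈ F, q ≤ c (E t)}, ∀ t' < t,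
      t' ∈ {s : ℝ | c (⨅ μ ∈ Set.Ioi s, outerDas K (E μ)) ∈ F} := by
    rintro t ⟨q, hq, hqE⟩ t' ht'
    have hEq : E t ≤ c q := by simpa only [hinv] using hanti _ _ hqE
    have hle : ⨅ μ ∈ Set.Ioi t', outerDas K (E μ) ≤ c q :=
      (iInf₂_le t ht').trans (outerDas_le (hcK_mem q (hFK hq)) hEq)
    have hmem : ⨅ μ ∈ Set.Ioi t', outerDas K (E μ) ∈ K := by
      rw [← sInf_image]
      exact hInf _ (Set.image_subset_iff.mpr fun μ _ => houter (E μ))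
    exact hup q hq _ (hcK_mem _ hmem) (by simpa only [hinv] using hanti _ _ hle)
  exact ⟨hsub, hlt, Real.sSup_eq_sSup_of_subset_of_forall_lt_mem hsub hlt⟩
end
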